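/- arXiv:2208.09029 — 5 statements merged into one kernel-verified Lean document; each statement's English description precedes it below -/
import Mathlib

section
/- For every i ∈ {1,…,n}, the empirical gap approximates the true gap: |Δ̂_i − Δ_i| ≤ 2ε. -/
/-- The `k`-th largest (1-indexed) value among `f 0, …, f (n-1)`; junk value `0` if out of range. -/
noncomputable def kthLargest {n : ℕ} (f : Fin n → ℝ) (k : ℕ) : ℝ :=
  if h : k - 1 < n then f (Tuple.sort f (Fin.rev ⟨k - 1, h⟩)) else 0

/-- The `k`-th smallest (1-indexed) value among `f 0, …, f (n-1)`; junk value `0` if out of range. -/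
noncomputable def kthSmallest {n : ℕ} (f : Fin n → ℝ) (k : ℕ) : ℝ :=
  if h : k - 1 < n then f (Tuple.sort f ⟨k - 1, h⟩) else 0

/-- The `k`-th largest (1-indexed) value of `f` over the finset `s`. -/
noncomputable def kthLargestOn {n : ℕ} (s : Finset (Fin n)) (f : Fin n → ℝ) (k : ℕ) : ℝ :=
  kthLargest (fun j : Fin s.card => f (s.orderIsoOfFin rfl j).1) k

/-- The `k`-th smallest (1-indexed) value of `f` over the finset `s`. -/
noncomputable def kthSmallestOn {n : ℕ} (s : Finset (Fin n)) (f : Fin n → ℝ) (k : ℕ) : ℝ :=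
  kthSmallest (fun j : Fin s.card => f (s.orderIsoOfFin rfl j).1) k

/-- Sorting is monotone: if `f ≤ g + c` pointwise, the same bound holds between the sorted values. -/
theorem sort_apply_le_add_of_le_add {n : ℕ} {f g : Fin n → ℝ} {c : ℝ}
    (h : ∀ i, f i ≤ g i + c) (k : Fin n) :
    f (Tuple.sort f k) ≤ g (Tuple.sort g k) + c := by
  obtain ⟨x, hx⟩ : (((Finset.Ici k).map (Tuple.sort f).toEmbedding) ∩
      ((Finset.Iic k).map (Tuple.sort g).toEmbedding)).Nonempty := by
    apply Finset.inter_nonempty_of_card_lt_card_add_card (Finset.subset_univ _)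
      (Finset.subset_univ _)
    simp only [Finset.card_map, Fin.card_Ici, Fin.card_Iic, Finset.card_univ, Fintype.card_fin]
    omega
  simp only [Finset.mem_inter, Finset.mem_map, Finset.mem_Ici, Finset.mem_Iic,
    Equiv.coe_toEmbedding] at hx
  obtain ⟨⟨a, hka, hax⟩, b, hbk, hbx⟩ := hx
  have hf : f (Tuple.sort f k) ≤ f (Tuple.sort f a) := Tuple.monotone_sort f hka
  have hg : g (Tuple.sort g b) ≤ g (Tuple.sort g k) := Tuple.monotone_sort g hbk
  rw [hax] at hf
  rw [hbx] at hg
  linarith [h x]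

/-- The `k`-th largest value is `1`-Lipschitz for the sup norm. -/
theorem abs_kthLargest_sub_le {n : ℕ} {f g : Fin n → ℝ} {c : ℝ} (hc : 0 ≤ c)
    (h : ∀ i, |f i - g i| ≤ c) (k : ℕ) : |kthLargest f k - kthLargest g k| ≤ c := by
  unfold kthLargest
  split_ifs with hk
  · have hfg := sort_apply_le_add_of_le_add (f := f) (g := g) (c := c)
      (fun i => by linarith [(abs_le.1 (h i)).2]) (Fin.rev ⟨k - 1, hk⟩)
    have hgf := sort_apply_le_add_of_le_add (f := g) (g := f) (c := c)
      (fun i => by linarith [(abs_le.1 (h i)).1]) (Fin.rev ⟨k - 1, hk⟩)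
    exact abs_le.2 ⟨by linarith, by linarith⟩
  · simpa using hc

/-- If `|μ̂_i − μ_i| ≤ ε` for every `i`, then the empirical gaps approximate the true gaps:
`|Δ̂_i − Δ_i| ≤ 2ε` for every arm `i`. -/
theorem stmt3 (n m : ℕ) (hm : 1 ≤ m) (hmn : m < n) (μ μhat : Fin n → ℝ)
    (ε : ℝ) (hε : 0 ≤ ε) (happrox : ∀ i, |μhat i - μ i| ≤ ε)
    (Δ Δhat : Fin n → ℝ)
    (hΔ : ∀ i, Δ i = max (μ i - kthLargest μ (m + 1)) (kthLargest μ m - μ i))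
    (hΔhat : ∀ i, Δhat i = max (μhat i - kthLargest μhat (m + 1)) (kthLargest μhat m - μhat i)) :
    ∀ i, |Δhat i - Δ i| ≤ 2 * ε := by
  intro i
  rw [hΔ, hΔhat]
  have hi := abs_le.1 (happrox i)
  have hlow := abs_le.1 (abs_kthLargest_sub_le hε happrox (m + 1))
  have htop := abs_le.1 (abs_kthLargest_sub_le hε happrox m)
  refine (abs_max_sub_max_le_max _ _ _ _).trans (max_le ?_ ?_) <;>
    exact abs_le.2 ⟨by linarith, by linarith⟩
end

section
/- (Induction step of the elimination algorithm.) Setting Q_{r+1} = Q_r ∪ A_r and I_{r+1} = I_r \ E_r, one has Q_{r+1} ⊆ Top and Top ⊆ Q_{r+1} ∪ I_{r+1}; moreover A_r ⊆ Top and (E_r \ A_r) ∩ Top = ∅. -/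
section OrderStatistics

open Finset

variable {n : ℕ}

lemma card_lt_apply_perm_le {f : Fin n → ℝ} {σ : Equiv.Perm (Fin n)}
    (hσ : Monotone fun k => f (σ k)) (p : Fin n) :
    #{i | f i < f (σ p)} ≤ p := by
  rw [← Fin.card_Iio p, ← card_map (s := Iio p) σ.toEmbedding]
  refine card_le_card fun i hi => ?_
  rw [mem_map_equiv, mem_Iio]
  by_contra! h
  have := hσ h
  simp only [Equiv.apply_symm_apply] at this
  exact absurd (mem_filter.1 hi).2 this.not_gt

lemma card_gt_apply_perm_le {f : Fin n → ℝ} {σ : Equiv.Perm (Fin n)}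
    (hσ : Monotone fun k => f (σ k)) (p : Fin n) :
    #{i | f (σ p) < f i} ≤ n - 1 - p := by
  rw [← Fin.card_Ioi p, ← card_map (s := Ioi p) σ.toEmbedding]
  refine card_le_card fun i hi => ?_
  rw [mem_map_equiv, mem_Ioi]
  by_contra! h
  have := hσ h
  simp only [Equiv.apply_symm_apply] at this
  exact absurd (mem_filter.1 hi).2 this.not_gt

lemma card_kthLargest_lt {f : Fin n → ℝ} {k : ℕ} (hk : 1 ≤ k) (hkn : k ≤ n) :
    #{i | kthLargest f k < f i} < k := by
  have h : k - 1 < n := by omega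
  have := card_gt_apply_perm_le (Tuple.monotone_sort f) (Fin.rev ⟨k - 1, h⟩)
  rw [kthLargest, dif_pos h]
  simp only [Fin.val_rev] at this
  omega

lemma le_card_kthLargest_le {f : Fin n → ℝ} {k : ℕ} (hk : 1 ≤ k) (hkn : k ≤ n) :
    k ≤ #{i | kthLargest f k ≤ f i} := by
  have h : k - 1 < n := by omega
  have := card_lt_apply_perm_le (Tuple.monotone_sort f) (Fin.rev ⟨k - 1, h⟩)
  have hc := card_filter_add_card_filter_not (s := (univ : Finset (Fin n)))
    (fun i => f i < kthLargest f k)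
  simp only [not_lt, card_univ, Fintype.card_fin] at hc
  rw [kthLargest, dif_pos h] at hc ⊢
  simp only [Fin.val_rev] at this
  omega

lemma le_card_le_kthSmallest {f : Fin n → ℝ} {k : ℕ} (hk : 1 ≤ k) (hkn : k ≤ n) :
    k ≤ #{i | f i ≤ kthSmallest f k} := by
  have h : k - 1 < n := by omega
  have := card_gt_apply_perm_le (Tuple.monotone_sort f) ⟨k - 1, h⟩
  have hc := card_filter_add_card_filter_not (s := (univ : Finset (Fin n)))
    (fun i => kthSmallest f k < f i)
  simp only [not_lt, card_univ, Fintype.card_fin] at hc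
  rw [kthSmallest, dif_pos h] at hc ⊢
  simp only at this
  omega

lemma card_filter_orderIsoOfFin (s : Finset (Fin n)) (P : Fin n → Prop) [DecidablePred P] :
    #{j : Fin s.card | P (s.orderIsoOfFin rfl j).1} = #{i ∈ s | P i} := by
  refine card_bij (fun j _ => (s.orderIsoOfFin rfl j).1) ?_ ?_ ?_
  · intro j hj
    exact mem_filter.2 ⟨(s.orderIsoOfFin rfl j).2, (mem_filter.1 hj).2⟩
  · intro j _ j' _ h
    exact (s.orderIsoOfFin rfl).injective (Subtype.ext h)
  · intro i hi
    obtain ⟨his, hP⟩ := mem_filter.1 hi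
    exact ⟨(s.orderIsoOfFin rfl).symm ⟨i, his⟩, mem_filter.2 ⟨mem_univ _, by simpa using hP⟩, by simp⟩

lemma card_kthLargestOn_lt {s : Finset (Fin n)} {f : Fin n → ℝ} {k : ℕ}
    (hk : 1 ≤ k) (hks : k ≤ #s) : #{i ∈ s | kthLargestOn s f k < f i} < k := by
  rw [← card_filter_orderIsoOfFin]
  exact card_kthLargest_lt hk hks

lemma le_card_kthLargestOn_le {s : Finset (Fin n)} {f : Fin n → ℝ} {k : ℕ}
    (hk : 1 ≤ k) (hks : k ≤ #s) : k ≤ #{i ∈ s | kthLargestOn s f k ≤ f i} := by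
  rw [← card_filter_orderIsoOfFin]
  exact le_card_kthLargest_le hk hks

lemma le_card_le_kthSmallestOn {s : Finset (Fin n)} {f : Fin n → ℝ} {k : ℕ}
    (hk : 1 ≤ k) (hks : k ≤ #s) : k ≤ #{i ∈ s | f i ≤ kthSmallestOn s f k} := by
  rw [← card_filter_orderIsoOfFin]
  exact le_card_le_kthSmallest hk hks

end OrderStatistics

section ExchangeArguments

open Finset

variable {α : Type*} [DecidableEq α]

/-- A set at least as large as `t` contains a given `i ∈ t` or an element outside `t`. -/
lemma mem_or_exists_mem_notMem_of_card_le {s t : Finset α} (h : #t ≤ #s) {i : α} (hi : i ∈ t) :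
    i ∈ s ∨ ∃ j ∈ s, j ∉ t := by
  by_cases hst : s ⊆ t
  · exact Or.inl (eq_of_subset_of_card_le hst h ▸ hi)
  · exact Or.inr (not_subset.1 hst)

/-- A set at most as large as `t` omits a given `i ∉ t` or an element of `t`. -/
lemma notMem_or_exists_mem_notMem_of_card_le {s t : Finset α} (h : #s ≤ #t) {i : α}
    (hi : i ∉ t) : i ∉ s ∨ ∃ j ∈ t, j ∉ s := by
  by_cases hst : t ⊆ s
  · exact Or.inl (eq_of_subset_of_card_le hst h ▸ hi)
  · exact Or.inr (not_subset.1 hst)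

end ExchangeArguments

/-- Induction step of the elimination algorithm: under the per-round concentration event,
setting `Q_{r+1} = Q_r ∪ A_r` and `I_{r+1} = I_r \ E_r` preserves the invariant
`Q_{r+1} ⊆ Top ⊆ Q_{r+1} ∪ I_{r+1}`; moreover `A_r ⊆ Top` and `(E_r \ A_r) ∩ Top = ∅`. -/
theorem stmt4 (n m : ℕ) (hm : 1 ≤ m) (hmn : m < n) (μ : Fin n → ℝ)
    (Δ : Fin n → ℝ)
    (hΔ : ∀ i, Δ i = max (μ i - kthLargest μ (m + 1)) (kthLargest μ m - μ i))
    (hpos : ∀ i, 0 < Δ i)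
    (π : Equiv.Perm (Fin n)) (hπ : Monotone fun k => Δ (π k))
    (Top : Finset (Fin n)) (hTopcard : Top.card = m)
    (hTop : ∀ i ∈ Top, ∀ j ∉ Top, μ j < μ i)
    (nr n1 : ℕ) (hn1 : 1 ≤ n1) (hn1nr : n1 ≤ nr) (hnrn : nr ≤ n)
    (Ir Qr : Finset (Fin n)) (hIcard : Ir.card = nr)
    (hdisj : Disjoint Qr Ir) (hQTop : Qr ⊆ Top) (hTopQI : Top ⊆ Qr ∪ Ir)
    (mr : ℕ) (hmr : mr = m - Qr.card) (hmr1 : 1 ≤ mr) (hmrnr : mr + 1 ≤ nr)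
    (μhat : Fin n → ℝ)
    (happrox : ∀ i ∈ Ir, |μhat i - μ i| < Δ (π ⟨n1 - 1, by omega⟩) / 8)
    (a b : ℝ) (ha : a = kthLargestOn Ir μhat mr) (hb : b = kthLargestOn Ir μhat (mr + 1))
    (Δhat : Fin n → ℝ)
    (hΔhat : ∀ i ∈ Ir, Δhat i = max (μhat i - b) (a - μhat i))
    (τ : ℝ) (hτ : τ = kthSmallestOn Ir Δhat n1)
    (Er Ar : Finset (Fin n))
    (hEr : Er = Ir.filter fun i => τ < Δhat i)
    (hAr : Ar = Er.filter fun i => a ≤ μhat i) :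
    (Qr ∪ Ar ⊆ Top) ∧ (Top ⊆ (Qr ∪ Ar) ∪ (Ir \ Er)) ∧
    (Ar ⊆ Top) ∧ ((Er \ Ar) ∩ Top = ∅) := by
  classical
  set D := Δ (π ⟨n1 - 1, by omega⟩) with hD
  have hDpos : 0 < D := hpos _
  have lower : ∀ i ∈ Ir, μ i - D / 8 < μhat i := fun i hi => by
    linarith [(abs_lt.1 (happrox i hi)).1]
  have upper : ∀ i ∈ Ir, μhat i < μ i + D / 8 := fun i hi => by
    linarith [(abs_lt.1 (happrox i hi)).2]
  have hTopIr : Top ∩ Ir = Top \ Qr := by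
    ext i
    have h1 := @hTopQI i
    have h2 : i ∈ Qr → i ∉ Ir := fun h => Finset.disjoint_left.1 hdisj h
    simp only [Finset.mem_inter, Finset.mem_sdiff, Finset.mem_union] at *
    tauto
  have hcard : (Top ∩ Ir).card = mr := by
    rw [hTopIr, Finset.card_sdiff_of_subset hQTop, hTopcard, hmr]
  have a_lt := card_kthLargestOn_lt (s := Ir) (f := μhat) (k := mr) hmr1 (by omega)
  have a_le := le_card_kthLargestOn_le (s := Ir) (f := μhat) (k := mr) hmr1 (by omega)
  have b_lt := card_kthLargestOn_lt (s := Ir) (f := μhat) (k := mr + 1) (by omega) (by omega)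
  have b_le := le_card_kthLargestOn_le (s := Ir) (f := μhat) (k := mr + 1) (by omega) (by omega)
  have τ_le := le_card_le_kthSmallestOn (s := Ir) (f := Δhat) hn1 (by omega)
  rw [← ha] at a_lt a_le
  rw [← hb] at b_lt b_le
  rw [← hτ] at τ_le
  have top_ge : ∀ t ∈ Top, kthLargest μ m ≤ μ t := by
    intro t ht
    have h := le_card_kthLargest_le (f := μ) hm hmn.le
    rcases mem_or_exists_mem_notMem_of_card_le (hTopcard.le.trans h) ht with h | ⟨j, hj, hjT⟩
    · exact (Finset.mem_filter.1 h).2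
    · exact (Finset.mem_filter.1 hj).2.trans (hTop t ht j hjT).le
  have bot_le : ∀ u ∉ Top, μ u ≤ kthLargest μ (m + 1) := by
    intro u hu
    have h := card_kthLargest_lt (f := μ) (k := m + 1) (by omega) hmn
    rcases notMem_or_exists_mem_notMem_of_card_le
      ((Nat.lt_succ_iff.1 h).trans hTopcard.ge) hu with h | ⟨j, hj, hjS⟩
    · simpa using h
    · have : μ j ≤ kthLargest μ (m + 1) := by simpa using hjS
      exact (hTop j hj u hu).le.trans this
  have a_upper : ∀ t ∈ Top, t ∈ Ir → a < μ t + D / 8 := by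
    intro t ht htI
    rcases mem_or_exists_mem_notMem_of_card_le (hcard.le.trans a_le)
      (Finset.mem_inter.2 ⟨ht, htI⟩) with h | ⟨j, hj, hjT⟩
    · exact (Finset.mem_filter.1 h).2.trans_lt (upper t htI)
    · obtain ⟨hjI, haj⟩ := Finset.mem_filter.1 hj
      have hjT' : j ∉ Top := fun h => hjT (Finset.mem_inter.2 ⟨h, hjI⟩)
      linarith [upper j hjI, hTop t ht j hjT']
  have b_lower : ∀ u ∉ Top, u ∈ Ir → μ u - D / 8 < b := by
    intro u hu huI
    rcases notMem_or_exists_mem_notMem_of_card_le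
      ((Nat.lt_succ_iff.1 b_lt).trans hcard.ge)
      (fun h => hu (Finset.mem_inter.1 h).1) with h | ⟨j, hj, hjS⟩
    · have : μhat u ≤ b := not_lt.1 fun h' => h (Finset.mem_filter.2 ⟨huI, h'⟩)
      linarith [lower u huI]
    · obtain ⟨hjT, hjI⟩ := Finset.mem_inter.1 hj
      have : μhat j ≤ b := not_lt.1 fun h' => hjS (Finset.mem_filter.2 ⟨hjI, h'⟩)
      linarith [lower j hjI, hTop j hjT u hu]
  have a_lower : kthLargest μ m - D / 8 < a := by
    obtain ⟨t, ht, htS⟩ := Finset.exists_mem_notMem_of_card_lt_card (a_lt.trans_le hcard.ge)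
    obtain ⟨htT, htI⟩ := Finset.mem_inter.1 ht
    have : μhat t ≤ a := not_lt.1 fun h' => htS (Finset.mem_filter.2 ⟨htI, h'⟩)
    linarith [lower t htI, top_ge t htT]
  have b_upper : b < kthLargest μ (m + 1) + D / 8 := by
    obtain ⟨u, hu, huS⟩ := Finset.exists_mem_notMem_of_card_lt_card
      ((Nat.lt_succ_of_le hcard.le).trans_le b_le)
    obtain ⟨huI, hbu⟩ := Finset.mem_filter.1 hu
    have huT : u ∉ Top := fun h => huS (Finset.mem_inter.2 ⟨h, huI⟩)
    linarith [upper u huI, bot_le u huT]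
  have τ_lower : 3 * D / 4 < τ := by
    have h := card_lt_apply_perm_le hπ ⟨n1 - 1, by omega⟩
    rw [← hD] at h
    obtain ⟨j, hj, hjS⟩ := Finset.exists_mem_notMem_of_card_lt_card
      (h.trans_lt ((Nat.sub_lt hn1 one_pos).trans_le τ_le))
    obtain ⟨hjI, hjτ⟩ := Finset.mem_filter.1 hj
    have hDj : D ≤ Δ j := by simpa using hjS
    rw [hΔhat j hjI] at hjτ
    refine lt_of_lt_of_le ?_ hjτ
    rw [hΔ j] at hDj
    rcases le_max_iff.1 hDj with h | h
    · exact lt_max_of_lt_left (by linarith [lower j hjI])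
    · exact lt_max_of_lt_right (by linarith [upper j hjI])
  have gap : ∀ i ∈ Er, i ∈ Ir ∧ (3 * D / 4 < μhat i - b ∨ 3 * D / 4 < a - μhat i) := by
    intro i hi
    rw [hEr] at hi
    obtain ⟨hiI, hiτ⟩ := Finset.mem_filter.1 hi
    rw [hΔhat i hiI] at hiτ
    exact ⟨hiI, lt_max_iff.1 (τ_lower.trans hiτ)⟩
  have accept : Ar ⊆ Top := by
    intro i hi
    rw [hAr] at hi
    obtain ⟨hiE, hai⟩ := Finset.mem_filter.1 hi
    obtain ⟨hiI, h⟩ := gap i hiE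
    by_contra hiT
    have h1 := b_lower i hiT hiI
    have h2 := upper i hiI
    rcases h with h | h <;> linarith
  have reject : ∀ i ∈ Er, i ∈ Top → i ∈ Ar := by
    intro i hiE hiT
    rw [hAr]
    refine Finset.mem_filter.2 ⟨hiE, ?_⟩
    by_contra! hai
    obtain ⟨hiI, h | h⟩ := gap i hiE
    · have hlt : (Ir.filter fun j => a ≤ μhat j).card < (Ir.filter fun j => b < μhat j).card := by
        refine Finset.card_lt_card (Finset.ssubset_iff_of_subset ?_ |>.2 ⟨i, ?_, ?_⟩)
        · exact Finset.monotone_filter_right _ fun j _ hj => by linarith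
        · exact Finset.mem_filter.2 ⟨hiI, by linarith⟩
        · exact fun h' => hai.not_ge (Finset.mem_filter.1 h').2
      omega
    · linarith [a_upper i hiT hiI, lower i hiI]
  refine ⟨Finset.union_subset hQTop accept, fun i hi => ?_, accept, ?_⟩
  · have h1 := hTopQI hi
    have h2 := reject i
    simp only [Finset.mem_union, Finset.mem_sdiff] at *
    tauto
  · ext i
    have h2 := reject i
    simp only [Finset.mem_inter, Finset.mem_sdiff, Finset.notMem_empty]
    tauto
end

section
/- (Separation property of the Set-Disjointness reduction.) For every i ∈ {1,…,n}: if X(i,k) = 1 for all k ∈ {1,…,K}, then μ_i > 2/3; and if X(i,k) = 0 for some k ∈ {1,…,K}, then μ_i < 2/3. Consequently, (∃ i ∈ {1,…,n} with μ_i > 2/3) if and only if (∃ i ∈ {1,…,n} such that X(i,k) = 1 for every k), i.e., if and only if DISJ(X) = 1. -/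
/-- Separation property of the Set-Disjointness reduction: with local means
`μ_{i,k} = (1+X(i,k))/3 + iδ` (for `i ∈ {1,…,n}`, encoded by `i : Fin n` as `i+1`)
and `δ = 1/n²`, an arm whose bits are all `1` has global mean `> 2/3`, an arm with
some bit `0` has global mean `< 2/3`; hence some global mean exceeds `2/3` iff
the `K` bit vectors intersect, i.e. iff `DISJ(X) = 1`. -/
theorem stmt9 (n K : ℕ) (hK : 0 < K) (hnK : 3 * K < n)
    (X : Fin n → Fin K → ℕ) (hX : ∀ i k, X i k = 0 ∨ X i k = 1)
    (δ : ℝ) (hδ : δ = 1 / (n : ℝ) ^ 2)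
    (μloc : Fin n → Fin K → ℝ)
    (hμloc : ∀ i k, μloc i k = (1 + (X i k : ℝ)) / 3 + ((i : ℕ) + 1) * δ)
    (μ : Fin n → ℝ) (hμ : ∀ i, μ i = (1 / (K : ℝ)) * ∑ k, μloc i k) :
    (∀ i : Fin n, ((∀ k, X i k = 1) → 2 / 3 < μ i) ∧ ((∃ k, X i k = 0) → μ i < 2 / 3)) ∧
    ((∃ i, 2 / 3 < μ i) ↔ ∃ i, ∀ k, X i k = 1) := by
  have hKpos : (0 : ℝ) < K := by exact_mod_cast hK
  have hnK' : 3 * (K : ℝ) < n := by exact_mod_cast hnK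
  have hn : (0 : ℝ) < n := by linarith
  have hδpos : 0 < δ := by rw [hδ]; positivity
  have hmean (i : Fin n) :
      μ i = (1 + (∑ k, (X i k : ℝ)) / K) / 3 + ((i : ℕ) + 1) * δ := by
    simp only [hμ, hμloc, Finset.sum_add_distrib, ← Finset.sum_div, Finset.sum_const,
      Finset.card_univ, Fintype.card_fin, nsmul_eq_mul]
    field_simp
  have hone (i : Fin n) (h : ∀ k, X i k = 1) : 2 / 3 < μ i := by
    have hshift : 0 < ((i : ℕ) + 1 : ℝ) * δ := by positivity
    have hsum : (∑ k, (X i k : ℝ)) / K = 1 := by simp [h, hKpos.ne']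
    rw [hmean, hsum]
    linarith
  have hzero (i : Fin n) (h : ∃ k, X i k = 0) : μ i < 2 / 3 := by
    obtain ⟨k₀, hk₀⟩ := h
    have hlt : ∑ k, X i k < K := by
      calc ∑ k, X i k < ∑ _k : Fin K, 1 :=
            Finset.sum_lt_sum (fun k _ => by have := hX i k; omega)
              ⟨k₀, Finset.mem_univ _, by omega⟩
        _ = K := by simp
    have hsum : (∑ k, (X i k : ℝ)) + 1 ≤ K := by exact_mod_cast hlt
    have hmeanBits : (∑ k, (X i k : ℝ)) / K ≤ 1 - 1 / K := by
      rw [div_le_iff₀ hKpos, sub_mul, one_div_mul_cancel hKpos.ne']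
      linarith
    have hi : ((i : ℕ) + 1 : ℝ) ≤ n := by exact_mod_cast i.isLt
    have hshift : ((i : ℕ) + 1 : ℝ) * δ ≤ 1 / n := by
      calc ((i : ℕ) + 1 : ℝ) * δ ≤ n * δ := by gcongr
        _ = 1 / n := by rw [hδ]; field_simp
    have hinv : 1 / (n : ℝ) < 1 / (3 * K) := one_div_lt_one_div_of_lt (by positivity) hnK'
    have hthird : 1 / (3 * (K : ℝ)) = 1 / K / 3 := by field_simp
    rw [hmean]
    linarith
  refine ⟨fun i => ⟨hone i, hzero i⟩, ?_, fun ⟨i, h⟩ => ⟨i, hone i h⟩⟩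
  rintro ⟨i, hi⟩
  refine ⟨i, fun k => (hX i k).resolve_left fun h => ?_⟩
  exact lt_asymm hi (hzero i ⟨k, h⟩)
end

section
/- (Remaining non-top arms have small empirical means.) Every arm i ∈ I_r \ Top satisfies μ̂_i ≤ b + Δ_{π(n_{r+1})}/4, where b is the (m_r+1)-th largest empirical mean over I_r. -/
/-- If at least `k` of the values of `f` are `≥ c`, then so is the `k`-th largest. -/
theorem le_kthLargest {n : ℕ} (f : Fin n → ℝ) {k : ℕ} (hk : 1 ≤ k) {c : ℝ} (T : Finset (Fin n))
    (hkT : k ≤ T.card) (hT : ∀ j ∈ T, c ≤ f j) : c ≤ kthLargest f k := by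
  have hTn : T.card ≤ n := by simpa using T.card_le_univ
  have h : k - 1 < n := by omega
  rw [kthLargest, dif_pos h]
  by_contra! hlt
  have hsub : T.map (Tuple.sort f).symm.toEmbedding ⊆ Finset.Ioi (Fin.rev ⟨k - 1, h⟩) := by
    intro p hp
    obtain ⟨j, hj, rfl⟩ := Finset.mem_map.1 hp
    rw [Finset.mem_Ioi]
    by_contra! hle
    have hmono := Tuple.monotone_sort f hle
    have hcj := hT j hj
    simp only [Function.comp_apply, Equiv.coe_toEmbedding, Equiv.apply_symm_apply] at hmono
    linarith
  have hcard := Finset.card_le_card hsub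
  rw [Finset.card_map, Fin.card_Ioi, Fin.val_rev] at hcard
  simp only at hcard
  omega

/-- If at least `k` of the values of `f` over `s` are `≥ c`, then so is the `k`-th largest. -/
theorem le_kthLargestOn {n : ℕ} {s : Finset (Fin n)} (f : Fin n → ℝ) {k : ℕ} (hk : 1 ≤ k) {c : ℝ}
    {T : Finset (Fin n)} (hTs : T ⊆ s) (hkT : k ≤ T.card) (hT : ∀ j ∈ T, c ≤ f j) :
    c ≤ kthLargestOn s f k := by
  refine le_kthLargest _ hk
    (Finset.univ.filter fun j : Fin s.card => (s.orderIsoOfFin rfl j).1 ∈ T) ?_ ?_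
  · refine hkT.trans ((Finset.card_le_card fun x hx => ?_).trans
      (Finset.card_image_le (f := fun j : Fin s.card => (s.orderIsoOfFin rfl j).1)))
    have hval : (s.orderIsoOfFin rfl ((s.orderIsoOfFin rfl).symm ⟨x, hTs hx⟩)).1 = x := by
      rw [OrderIso.apply_symm_apply]
    exact Finset.mem_image.2 ⟨(s.orderIsoOfFin rfl).symm ⟨x, hTs hx⟩,
      Finset.mem_filter.2 ⟨Finset.mem_univ _, by rwa [hval]⟩, hval⟩
  · intro j hj
    exact hT _ (Finset.mem_filter.1 hj).2

/-- Remaining non-top arms have small empirical means: every `i ∈ I_r \ Top` satisfies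
`μ̂_i ≤ b + Δ_{π(n_{r+1})}/4`, where `b` is the `(m_r+1)`-th largest empirical mean over `I_r`. -/
theorem stmt13 (n m : ℕ) (hm : 1 ≤ m) (hmn : m < n) (μ : Fin n → ℝ)
    (Δ : Fin n → ℝ)
    (hΔ : ∀ i, Δ i = max (μ i - kthLargest μ (m + 1)) (kthLargest μ m - μ i))
    (hpos : ∀ i, 0 < Δ i)
    (π : Equiv.Perm (Fin n)) (hπ : Monotone fun k => Δ (π k))
    (Top : Finset (Fin n)) (hTopcard : Top.card = m)
    (hTop : ∀ i ∈ Top, ∀ j ∉ Top, μ j < μ i)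
    (nr n1 : ℕ) (hn1 : 1 ≤ n1) (hn1nr : n1 ≤ nr) (hnrn : nr ≤ n)
    (Ir Qr : Finset (Fin n)) (hIcard : Ir.card = nr)
    (hdisj : Disjoint Qr Ir) (hQTop : Qr ⊆ Top) (hTopQI : Top ⊆ Qr ∪ Ir)
    (mr : ℕ) (hmr : mr = m - Qr.card) (hmr1 : 1 ≤ mr) (hmrnr : mr + 1 ≤ nr)
    (μhat : Fin n → ℝ)
    (happrox : ∀ i ∈ Ir, |μhat i - μ i| < Δ (π ⟨n1 - 1, by omega⟩) / 8)
    (b : ℝ) (hb : b = kthLargestOn Ir μhat (mr + 1)) :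
    ∀ i ∈ Ir \ Top, μhat i ≤ b + Δ (π ⟨n1 - 1, by omega⟩) / 4 := by
  intro i hi
  obtain ⟨hiI, hiT⟩ := Finset.mem_sdiff.1 hi
  have hδ := hpos (π ⟨n1 - 1, by omega⟩)
  have hsub : Top \ Qr ⊆ Ir := fun j hj =>
    (Finset.mem_union.1 (hTopQI (Finset.mem_sdiff.1 hj).1)).resolve_left (Finset.mem_sdiff.1 hj).2
  have hcard : (insert i (Top \ Qr)).card = mr + 1 := by
    rw [Finset.card_insert_of_notMem fun h => hiT (Finset.mem_sdiff.1 h).1,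
      Finset.card_sdiff_of_subset hQTop, hTopcard, hmr]
  have hle : μhat i - Δ (π ⟨n1 - 1, by omega⟩) / 4 ≤ kthLargestOn Ir μhat (mr + 1) := by
    refine le_kthLargestOn μhat (by omega) (Finset.insert_subset hiI hsub) hcard.ge ?_
    intro j hj
    rcases Finset.mem_insert.1 hj with rfl | hj
    · linarith
    · have hμ := hTop j (Finset.mem_sdiff.1 hj).1 i hiT
      have hi' := (abs_lt.1 (happrox i hiI)).2
      have hj' := (abs_lt.1 (happrox j (hsub hj))).1
      linarith
  linarith
end

section
/- (Empirical gaps dominate true gaps up to the threshold, and the elimination threshold is large.) For every i ∈ I_r, the empirical gap satisfies Δ̂_i ≥ Δ_i − Δ_{π(n_{r+1})}/4, where Δ_i is the (global) gap of arm i. Consequently, the n_{r+1}-th smallest empirical gap τ over I_r satisfies τ ≥ (3/4) · Δ_{π(n_{r+1})}, and hence every i ∈ E_r has Δ̂_i ≥ (3/4) · Δ_{π(n_{r+1})}. -/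
theorem exists_mem_le_of_monotone_comp {n : ℕ} (f : Fin n → ℝ) (σ : Equiv.Perm (Fin n))
    (hσ : Monotone (f ∘ σ)) (j : Fin n) (t : Finset (Fin n)) (ht : n < t.card + (j + 1)) :
    ∃ i ∈ t, f i ≤ f (σ j) := by
  have hcard : Fintype.card (Fin n) < t.card + ((Finset.Iic j).map σ.toEmbedding).card := by
    simpa using ht
  obtain ⟨i, hi⟩ := Finset.inter_nonempty_of_card_lt_card_add_card
    (Finset.subset_univ t) (Finset.subset_univ _) hcard
  obtain ⟨hit, hi⟩ := Finset.mem_inter.1 hi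
  obtain ⟨l, hl, rfl⟩ := Finset.mem_map.1 hi
  exact ⟨_, hit, hσ (Finset.mem_Iic.1 hl)⟩

theorem exists_mem_ge_of_monotone_comp {n : ℕ} (f : Fin n → ℝ) (σ : Equiv.Perm (Fin n))
    (hσ : Monotone (f ∘ σ)) (j : Fin n) (t : Finset (Fin n)) (ht : j < t.card) :
    ∃ i ∈ t, f (σ j) ≤ f i := by
  have hcard : Fintype.card (Fin n) < t.card + ((Finset.Ici j).map σ.toEmbedding).card := by
    simp only [Fintype.card_fin, Finset.card_map, Fin.card_Ici]
    omega
  obtain ⟨i, hi⟩ := Finset.inter_nonempty_of_card_lt_card_add_card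
    (Finset.subset_univ t) (Finset.subset_univ _) hcard
  obtain ⟨hit, hi⟩ := Finset.mem_inter.1 hi
  obtain ⟨l, hl, rfl⟩ := Finset.mem_map.1 hi
  exact ⟨_, hit, hσ (Finset.mem_Ici.1 hl)⟩

theorem exists_mem_le_kthSmallest {n : ℕ} (f : Fin n → ℝ) {k : ℕ} (hk : 1 ≤ k) (hkn : k ≤ n)
    (t : Finset (Fin n)) (ht : n < t.card + k) : ∃ i ∈ t, f i ≤ kthSmallest f k := by
  rw [kthSmallest, dif_pos (by omega)]
  exact exists_mem_le_of_monotone_comp f _ (Tuple.monotone_sort f) _ t (by simp only; omega)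

theorem exists_mem_le_kthLargest {n : ℕ} (f : Fin n → ℝ) {k : ℕ} (hk : 1 ≤ k) (hkn : k ≤ n)
    (t : Finset (Fin n)) (ht : k ≤ t.card) : ∃ i ∈ t, f i ≤ kthLargest f k := by
  rw [kthLargest, dif_pos (by omega)]
  exact exists_mem_le_of_monotone_comp f _ (Tuple.monotone_sort f) _ t
    (by simp only [Fin.val_rev]; omega)

theorem exists_mem_ge_kthLargest {n : ℕ} (f : Fin n → ℝ) {k : ℕ} (hk : 1 ≤ k) (hkn : k ≤ n)
    (t : Finset (Fin n)) (ht : n < t.card + k) : ∃ i ∈ t, kthLargest f k ≤ f i := by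
  rw [kthLargest, dif_pos (by omega)]
  exact exists_mem_ge_of_monotone_comp f _ (Tuple.monotone_sort f) _ t
    (by simp only [Fin.val_rev]; omega)

theorem card_filter_orderIsoOfFin_mem {n : ℕ} {s t : Finset (Fin n)} (hts : t ⊆ s) :
    (Finset.univ.filter fun j : Fin s.card => (s.orderIsoOfFin rfl j).1 ∈ t).card = t.card := by
  refine Finset.card_bij (fun j _ => (s.orderIsoOfFin rfl j).1)
    (fun j hj => (Finset.mem_filter.1 hj).2)
    (fun j _ l _ h => (s.orderIsoOfFin rfl).injective (Subtype.ext h)) fun i hi => ?_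
  obtain ⟨j, hj⟩ := (s.orderIsoOfFin rfl).surjective ⟨i, hts hi⟩
  have hji : (s.orderIsoOfFin rfl j).1 = i := congrArg Subtype.val hj
  exact ⟨j, Finset.mem_filter.2 ⟨Finset.mem_univ _, hji.symm ▸ hi⟩, hji⟩

theorem exists_mem_le_kthSmallestOn {n : ℕ} {s t : Finset (Fin n)} (hts : t ⊆ s) (f : Fin n → ℝ)
    {k : ℕ} (hk : 1 ≤ k) (hks : k ≤ s.card) (ht : s.card < t.card + k) :
    ∃ i ∈ t, f i ≤ kthSmallestOn s f k := by
  rw [← card_filter_orderIsoOfFin_mem hts] at ht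
  obtain ⟨j, hj, hle⟩ := exists_mem_le_kthSmallest _ hk hks _ ht
  exact ⟨_, (Finset.mem_filter.1 hj).2, hle⟩

theorem exists_mem_le_kthLargestOn {n : ℕ} {s t : Finset (Fin n)} (hts : t ⊆ s) (f : Fin n → ℝ)
    {k : ℕ} (hk : 1 ≤ k) (hks : k ≤ s.card) (ht : k ≤ t.card) :
    ∃ i ∈ t, f i ≤ kthLargestOn s f k := by
  rw [← card_filter_orderIsoOfFin_mem hts] at ht
  obtain ⟨j, hj, hle⟩ := exists_mem_le_kthLargest _ hk hks _ ht
  exact ⟨_, (Finset.mem_filter.1 hj).2, hle⟩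

theorem exists_mem_ge_kthLargestOn {n : ℕ} {s t : Finset (Fin n)} (hts : t ⊆ s) (f : Fin n → ℝ)
    {k : ℕ} (hk : 1 ≤ k) (hks : k ≤ s.card) (ht : s.card < t.card + k) :
    ∃ i ∈ t, kthLargestOn s f k ≤ f i := by
  rw [← card_filter_orderIsoOfFin_mem hts] at ht
  obtain ⟨j, hj, hle⟩ := exists_mem_ge_kthLargest _ hk hks _ ht
  exact ⟨_, (Finset.mem_filter.1 hj).2, hle⟩

theorem card_filter_lt_of_monotone_comp {n : ℕ} (f : Fin n → ℝ) (σ : Equiv.Perm (Fin n))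
    (hσ : Monotone (f ∘ σ)) (j : Fin n) :
    (Finset.univ.filter fun i => f i < f (σ j)).card ≤ j := by
  by_contra! h
  obtain ⟨i, hi, hle⟩ := exists_mem_ge_of_monotone_comp f σ hσ j _ h
  exact absurd hle (not_le.2 (Finset.mem_filter.1 hi).2)

/-- Empirical gaps dominate true gaps up to the threshold: for `i ∈ I_r`,
`Δ̂_i ≥ Δ_i − Δ_{π(n_{r+1})}/4`; consequently the `n_{r+1}`-th smallest empirical gap `τ`
satisfies `τ ≥ (3/4)Δ_{π(n_{r+1})}`, and every `i ∈ E_r` has `Δ̂_i ≥ (3/4)Δ_{π(n_{r+1})}`. -/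
theorem stmt14 (n m : ℕ) (hm : 1 ≤ m) (hmn : m < n) (μ : Fin n → ℝ)
    (Δ : Fin n → ℝ)
    (hΔ : ∀ i, Δ i = max (μ i - kthLargest μ (m + 1)) (kthLargest μ m - μ i))
    (hpos : ∀ i, 0 < Δ i)
    (π : Equiv.Perm (Fin n)) (hπ : Monotone fun k => Δ (π k))
    (Top : Finset (Fin n)) (hTopcard : Top.card = m)
    (hTop : ∀ i ∈ Top, ∀ j ∉ Top, μ j < μ i)
    (nr n1 : ℕ) (hn1 : 1 ≤ n1) (hn1nr : n1 ≤ nr) (hnrn : nr ≤ n)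
    (Ir Qr : Finset (Fin n)) (hIcard : Ir.card = nr)
    (hdisj : Disjoint Qr Ir) (hQTop : Qr ⊆ Top) (hTopQI : Top ⊆ Qr ∪ Ir)
    (mr : ℕ) (hmr : mr = m - Qr.card) (hmr1 : 1 ≤ mr) (hmrnr : mr + 1 ≤ nr)
    (μhat : Fin n → ℝ)
    (happrox : ∀ i ∈ Ir, |μhat i - μ i| < Δ (π ⟨n1 - 1, by omega⟩) / 8)
    (a b : ℝ) (ha : a = kthLargestOn Ir μhat mr) (hb : b = kthLargestOn Ir μhat (mr + 1))
    (Δhat : Fin n → ℝ)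
    (hΔhat : ∀ i ∈ Ir, Δhat i = max (μhat i - b) (a - μhat i))
    (τ : ℝ) (hτ : τ = kthSmallestOn Ir Δhat n1)
    (Er : Finset (Fin n)) (hEr : Er = Ir.filter fun i => τ < Δhat i) :
    (∀ i ∈ Ir, Δ i - Δ (π ⟨n1 - 1, by omega⟩) / 4 ≤ Δhat i) ∧
    (3 / 4 * Δ (π ⟨n1 - 1, by omega⟩) ≤ τ) ∧
    (∀ i ∈ Er, 3 / 4 * Δ (π ⟨n1 - 1, by omega⟩) ≤ Δhat i) := by
  have hTopge : ∀ i ∈ Top, kthLargest μ m ≤ μ i := by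
    intro i hi
    have hcard : (insert i Topᶜ).card = n - m + 1 := by
      rw [Finset.card_insert_of_notMem (by simpa using hi), Finset.card_compl, hTopcard,
        Fintype.card_fin]
    obtain ⟨l, hl, hle⟩ := exists_mem_ge_kthLargest μ hm hmn.le (insert i Topᶜ) (by omega)
    rcases Finset.mem_insert.1 hl with rfl | hl
    · exact hle
    · exact hle.trans (hTop i hi l (Finset.mem_compl.1 hl)).le
  have hTople : ∀ j ∉ Top, μ j ≤ kthLargest μ (m + 1) := by
    intro j hj
    obtain ⟨l, hl, hle⟩ := exists_mem_le_kthLargest μ (k := m + 1) (by omega) hmn (insert j Top)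
      (by rw [Finset.card_insert_of_notMem hj, hTopcard])
    rcases Finset.mem_insert.1 hl with rfl | hl
    · exact hle
    · exact (hTop l hl j hj).le.trans hle
  generalize hD : Δ (π ⟨n1 - 1, by omega⟩) = D at happrox ⊢
  have hTQ : Top \ Qr ⊆ Ir := fun i hi => by
    obtain ⟨hiT, hiQ⟩ := Finset.mem_sdiff.1 hi
    exact (Finset.mem_union.1 (hTopQI hiT)).resolve_left hiQ
  have hTQcard : (Top \ Qr).card = mr := by
    rw [Finset.card_sdiff_of_subset hQTop, hTopcard, hmr]
  have hrest : Ir \ (Top \ Qr) ⊆ Ir := Finset.sdiff_subset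
  have hrestcard : (Ir \ (Top \ Qr)).card = nr - mr := by
    rw [Finset.card_sdiff_of_subset hTQ, hIcard, hTQcard]
  have ha_ge : kthLargest μ m - D / 8 ≤ a := by
    obtain ⟨i, hi, hle⟩ := exists_mem_le_kthLargestOn hTQ μhat hmr1 (by omega) hTQcard.ge
    have := abs_lt.1 (happrox i (hTQ hi))
    have := hTopge i (Finset.mem_sdiff.1 hi).1
    linarith
  have hb_le : b ≤ kthLargest μ (m + 1) + D / 8 := by
    obtain ⟨i, hi, hle⟩ := exists_mem_ge_kthLargestOn hrest μhat (k := mr + 1) (by omega)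
      (by omega) (by omega)
    have := abs_lt.1 (happrox i (hrest hi))
    have hiT : i ∉ Top := fun hiT =>
      (Finset.mem_sdiff.1 hi).2 (Finset.mem_sdiff.2
        ⟨hiT, Finset.disjoint_right.1 hdisj (hrest hi)⟩)
    have := hTople i hiT
    linarith
  have hgap : ∀ i ∈ Ir, Δ i - D / 4 ≤ Δhat i := by
    intro i hi
    have := abs_lt.1 (happrox i hi)
    rw [hΔ i, hΔhat i hi, sub_le_iff_le_add]
    apply max_le
    · linarith [le_max_left (μhat i - b) (a - μhat i)]
    · linarith [le_max_right (μhat i - b) (a - μhat i)]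
  have hτD : 3 / 4 * D ≤ τ := by
    have hsmall := card_filter_lt_of_monotone_comp Δ π hπ ⟨n1 - 1, by omega⟩
    rw [hD] at hsmall
    have hcard := Finset.le_card_sdiff (Finset.univ.filter fun i => Δ i < D) Ir
    obtain ⟨i, hi, hle⟩ := exists_mem_le_kthSmallestOn
      (t := Ir \ Finset.univ.filter fun i => Δ i < D) Finset.sdiff_subset Δhat hn1 (by omega)
      (by simp only at hsmall; omega)
    obtain ⟨hiI, hiD⟩ := Finset.mem_sdiff.1 hi
    have hDi : D ≤ Δ i := by simpa using hiD
    linarith [hgap i hiI]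
  refine ⟨hgap, hτD, fun i hi => ?_⟩
  rw [hEr] at hi
  exact hτD.trans (Finset.mem_filter.1 hi).2.le
end
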